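/- Let (X,c_i,c_j) be a digital picture with {i,j} = {1,2} such that X is nonempty, c_i-connected, and has no hole. Then (X,c_i,c_j) is homotopy equivalent to (H_r(X),c_i,c_j), where H_r(X) is the row-convex hull of X. -/

import Mathlib

/-- Points of the digital plane. -/
abbrev Pt : Type := ℤ × ℤ

/-- `c_i`-adjacency on `ℤ²` (for `i = 1` or `i = 2`). -/
def cAdj (i : ℕ) (x y : Pt) : Prop :=
  if i = 1 then |x.1 - y.1| + |x.2 - y.2| ≤ 1
  else |x.1 - y.1| ≤ 1 ∧ |x.2 - y.2| ≤ 1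

/-- The adjacency induced on a subset of `ℤ²`. -/
def subAdj (i : ℕ) (X : Set Pt) (x y : X) : Prop := cAdj i x.1 y.1

/-- Digital continuity of a map between digital images. -/
def DigCont {α β : Type} (κ : α → α → Prop) (δ : β → β → Prop) (f : α → β) : Prop :=
  ∀ x y, κ x y → δ (f x) (f y)

/-- The standard (`c_1`) adjacency on `ℕ`, used for digital intervals. -/
def natAdj (s t : ℕ) : Prop := s = t ∨ s + 1 = t ∨ t + 1 = s

/-- The two normal product adjacencies on `α × ℕ`. -/
def prodAdj (i : ℕ) {α : Type} (κ : α → α → Prop) (p q : α × ℕ) : Prop :=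
  if i = 1 then (κ p.1 q.1 ∧ p.2 = q.2) ∨ (p.1 = q.1 ∧ natAdj p.2 q.2)
  else κ p.1 q.1 ∧ natAdj p.2 q.2

/-- `f` and `g` are `i`-homotopic: there is a continuous
`H : X ×_i [0,m]_ℤ → Y` with `H(·,0) = f` and `H(·,m) = g`. -/
def Homotopic (i : ℕ) {α β : Type} (κ : α → α → Prop) (δ : β → β → Prop)
    (f g : α → β) : Prop :=
  ∃ (m : ℕ) (H : α → ℕ → β),
    (∀ x, H x 0 = f x) ∧ (∀ x, H x m = g x) ∧
    (∀ x y s t, s ≤ m → t ≤ m → prodAdj i κ (x, s) (y, t) → δ (H x s) (H y t))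

/-- `i`-homotopy equivalence of digital images. -/
def HtpyEquiv (i : ℕ) {α β : Type} (κ : α → α → Prop) (δ : β → β → Prop) : Prop :=
  ∃ (f : α → β) (g : β → α),
    DigCont κ δ f ∧ DigCont δ κ g ∧
    Homotopic i κ κ (g ∘ f) id ∧ Homotopic i δ δ (f ∘ g) id

/-- Homotopy equivalence of digital pictures `(X, c_i, c_j)` and `(Y, c_i, c_j)`. -/
def PicHtpyEquiv (i j : ℕ) (X Y : Set Pt) : Prop :=
  HtpyEquiv i (subAdj i X) (subAdj i Y) ∧ HtpyEquiv j (subAdj j Xᶜ) (subAdj j Yᶜ)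

/-- Isomorphism of digital images: a continuous bijection with continuous inverse. -/
def DigIso {α β : Type} (κ : α → α → Prop) (δ : β → β → Prop) : Prop :=
  ∃ e : α ≃ β, DigCont κ δ ⇑e ∧ DigCont δ κ ⇑e.symm

/-- Isomorphism of digital pictures. -/
def PicIso (i j : ℕ) (X Y : Set Pt) : Prop :=
  DigIso (subAdj i X) (subAdj i Y) ∧ DigIso (subAdj j Xᶜ) (subAdj j Yᶜ)

/-- `x` and `y` are joined by a `c_i`-path inside `A`. -/
def ChainIn (i : ℕ) (A : Set Pt) (x y : Pt) : Prop :=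
  ∃ (n : ℕ) (c : ℕ → Pt), c 0 = x ∧ c n = y ∧ (∀ k ≤ n, c k ∈ A) ∧
    ∀ k < n, cAdj i (c k) (c (k + 1))

/-- `A` is `c_i`-connected. -/
def Conn (i : ℕ) (A : Set Pt) : Prop := ∀ x ∈ A, ∀ y ∈ A, ChainIn i A x y

/-- The `c_i`-component of `p` in `A`. -/
def compOf (i : ℕ) (A : Set Pt) (p : Pt) : Set Pt := {y | ChainIn i A p y}

/-- The digital picture `(X, c_i, c_j)` has no hole: every `c_j`-component
of the complement of `X` is infinite. -/
def NoHole (j : ℕ) (X : Set Pt) : Prop := ∀ p ∈ Xᶜ, (compOf j Xᶜ p).Infinite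

/-- The row of `X` at height `k`. -/
def rowOf (X : Set Pt) (k : ℤ) : Set Pt := X ∩ {p | p.2 = k}

/-- `r` is a row component of `(X, c_i)`: a `c_i`-component of a row of `X`. -/
def IsRowComp (i : ℕ) (X : Set Pt) (r : Set Pt) : Prop :=
  ∃ (k : ℤ) (p : Pt), p ∈ rowOf X k ∧ r = compOf i (rowOf X k) p

/-- Two subsets of `ℤ²` are `c_i`-adjacent. -/
def setAdj (i : ℕ) (A B : Set Pt) : Prop := ∃ a ∈ A, ∃ b ∈ B, cAdj i a b

/-- The edge relation of the row component graph `R(X, c_i)`: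
two distinct row components joined when they are `c_i`-adjacent. -/
def rcgAdj (i : ℕ) (X : Set Pt) (r s : Set Pt) : Prop :=
  IsRowComp i X r ∧ IsRowComp i X s ∧ r ≠ s ∧ setAdj i r s

/-- The row component graph `R(X, c_i)` is acyclic: there is no cycle of
`k ≥ 3` distinct row components with consecutive ones adjacent. -/
def RCGAcyclic (i : ℕ) (X : Set Pt) : Prop :=
  ¬ ∃ (k : ℕ) (r : ℕ → Set Pt), 3 ≤ k ∧
    (∀ t < k, IsRowComp i X (r t)) ∧
    (∀ t < k, ∀ t' < k, r t = r t' → t = t') ∧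
    (∀ t, t + 1 < k → rcgAdj i X (r t) (r (t + 1))) ∧
    rcgAdj i X (r (k - 1)) (r 0)

/-- The row component graph `R(X, c_i)` is connected. -/
def RCGConnected (i : ℕ) (X : Set Pt) : Prop :=
  ∀ r s : Set Pt, IsRowComp i X r → IsRowComp i X s →
    Relation.ReflTransGen (rcgAdj i X) r s

/-- A digital image is `i`-contractible: the identity is `i`-homotopic to a constant map. -/
def Contractible (i : ℕ) {α : Type} (κ : α → α → Prop) : Prop :=
  ∃ x₀ : α, Homotopic i κ κ id (fun _ => x₀)

/-- Row-convexity. -/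
def RowConvex (X : Set Pt) : Prop :=
  ∀ a b c k : ℤ, (a, k) ∈ X → (c, k) ∈ X → a ≤ b → b ≤ c → (b, k) ∈ X

/-- Column-convexity. -/
def ColConvex (X : Set Pt) : Prop :=
  ∀ a b c k : ℤ, (k, a) ∈ X → (k, c) ∈ X → a ≤ b → b ≤ c → (k, b) ∈ X

/-- The row-convex hull of `X`. -/
def Hr (X : Set Pt) : Set Pt := ⋂₀ {S | RowConvex S ∧ X ⊆ S}

/-- The column-convex hull of `X`. -/
def Hc (X : Set Pt) : Set Pt := ⋂₀ {S | ColConvex S ∧ X ⊆ S}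

/-- The rc-convex hull of `X`. -/
def Hrc (X : Set Pt) : Set Pt := ⋂₀ {S | (RowConvex S ∧ ColConvex S) ∧ X ⊆ S}

/-- A loop of length `m` inside `Z`: a continuous `γ : [0,m]_ℤ → Z` with `γ 0 = γ m`. -/
def LoopIn (j : ℕ) (Z : Set Pt) (m : ℕ) (γ : ℕ → Pt) : Prop :=
  γ 0 = γ m ∧ (∀ t ≤ m, γ t ∈ Z) ∧ ∀ t < m, cAdj j (γ t) (γ (t + 1))

/-- The loop `γ` is `j`-contractible in `Z`: there is a `j`-homotopy in `Z` from `γ`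
to the constant loop at `γ 0` whose every stage is a loop based at `γ 0`. -/
def LoopContractibleIn (j : ℕ) (Z : Set Pt) (m : ℕ) (γ : ℕ → Pt) : Prop :=
  ∃ (K : ℕ) (H : ℕ → ℕ → Pt),
    (∀ t, H t 0 = γ t) ∧ (∀ t, H t K = γ 0) ∧
    (∀ k ≤ K, H 0 k = γ 0 ∧ H m k = γ 0) ∧
    (∀ t ≤ m, ∀ k ≤ K, H t k ∈ Z) ∧
    (∀ s t k l, s ≤ m → t ≤ m → k ≤ K → l ≤ K →
      prodAdj j natAdj (s, k) (t, l) → cAdj j (H s k) (H t l))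

/-- The union of the infinite `c_j`-components of the complement of `X`. -/
def InfPart (j : ℕ) (X : Set Pt) : Set Pt := {p | p ∈ Xᶜ ∧ (compOf j Xᶜ p).Infinite}

/-- The outer perimeter of the digital picture `(X, c_i, c_j)`: the least length of a
non-`j`-contractible loop in the infinite component of the complement of `X`, or `1`
if no such loop exists.  (It depends only on `j` and `X`.) -/
noncomputable def outerPerim (j : ℕ) (X : Set Pt) : ℕ := by
  classical
  exact if (∃ m γ, LoopIn j (InfPart j X) m γ ∧ ¬ LoopContractibleIn j (InfPart j X) m γ)
    then sInf {m | ∃ γ, LoopIn j (InfPart j X) m γ ∧ ¬ LoopContractibleIn j (InfPart j X) m γ}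
    else 1

/-- The digital rectangle `I_{n,m} = [1,n]_ℤ × [1,m]_ℤ`. -/
def Irect (n m : ℤ) : Set Pt := Set.Icc 1 n ×ˢ Set.Icc 1 m

/-- A finite digital image is `i`-reducible when it is `i`-homotopy equivalent to a
digital image with strictly fewer points. -/
def Reducible (i : ℕ) {α : Type} (κ : α → α → Prop) : Prop :=
  ∃ (β : Type) (δ : β → β → Prop), Reflexive δ ∧ Symmetric δ ∧ Finite β ∧
    Nat.card β < Nat.card α ∧ HtpyEquiv i κ δ

/-! ### Adjacency and connectedness -/

/-- The two digital adjacencies in linear form: `e = 0` gives `c_1` and `e = 1` gives `c_2`. -/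
def PlaneAdj (e : ℤ) (x y : Pt) : Prop :=
  (x.2 = y.2 ∧ -1 ≤ x.1 - y.1 ∧ x.1 - y.1 ≤ 1) ∨
    (-e ≤ x.1 - y.1 ∧ x.1 - y.1 ≤ e ∧ -1 ≤ x.2 - y.2 ∧ x.2 - y.2 ≤ 1)

theorem cAdj_one_iff (x y : Pt) : cAdj 1 x y ↔ PlaneAdj 0 x y := by
  unfold cAdj PlaneAdj
  rw [if_pos rfl]
  rcases abs_cases (x.1 - y.1) with h | h <;> rcases abs_cases (x.2 - y.2) with h' | h' <;>
    rw [h.1, h'.1] <;> omega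

theorem cAdj_two_iff (x y : Pt) : cAdj 2 x y ↔ PlaneAdj 1 x y := by
  unfold cAdj PlaneAdj
  rw [if_neg (by decide), abs_le, abs_le]
  omega

/-- `i` is the index and `e` the linear parameter of the same adjacency. -/
def AdjIndex (i : ℕ) (e : ℤ) : Prop := (i = 1 ∧ e = 0) ∨ (i = 2 ∧ e = 1)

theorem AdjIndex.cAdj_iff {i : ℕ} {e : ℤ} (h : AdjIndex i e) (x y : Pt) :
    cAdj i x y ↔ PlaneAdj e x y := by
  rcases h with ⟨rfl, rfl⟩ | ⟨rfl, rfl⟩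
  · exact cAdj_one_iff x y
  · exact cAdj_two_iff x y

theorem AdjIndex.bounds {i : ℕ} {e : ℤ} (h : AdjIndex i e) : 0 ≤ e ∧ e ≤ 1 := by
  rcases h with ⟨-, rfl⟩ | ⟨-, rfl⟩ <;> norm_num

theorem PlaneAdj.symm {e : ℤ} {x y : Pt} (h : PlaneAdj e x y) : PlaneAdj e y x := by
  unfold PlaneAdj at *
  omega

/-- `x` and `y` are joined by a path in `A`. -/
def PathJoined (e : ℤ) (A : Set Pt) (x y : Pt) : Prop :=
  Relation.ReflTransGen (fun a b => a ∈ A ∧ b ∈ A ∧ PlaneAdj e a b) x y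

/-- Any two points of `A` are joined by a path in `A`. -/
def PathConn (e : ℤ) (A : Set Pt) : Prop := ∀ x ∈ A, ∀ y ∈ A, PathJoined e A x y

theorem PathJoined.symm {e : ℤ} {A : Set Pt} {x y : Pt} (h : PathJoined e A x y) :
    PathJoined e A y x := by
  induction h with
  | refl => exact Relation.ReflTransGen.refl
  | tail _ h ih => exact Relation.ReflTransGen.head ⟨h.2.1, h.1, h.2.2.symm⟩ ih

theorem PathJoined.trans {e : ℤ} {A : Set Pt} {x y z : Pt} (h : PathJoined e A x y)
    (h' : PathJoined e A y z) : PathJoined e A x z :=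
  Relation.ReflTransGen.trans h h'

theorem PathJoined.mono {e : ℤ} {A B : Set Pt} (hAB : A ⊆ B) {x y : Pt}
    (h : PathJoined e A x y) : PathJoined e B x y :=
  Relation.ReflTransGen.mono (fun _ _ h => ⟨hAB h.1, hAB h.2.1, h.2.2⟩) _ _ h

theorem pathJoined_of_adj {e : ℤ} {A : Set Pt} {x y : Pt} (hx : x ∈ A) (hy : y ∈ A)
    (h : PlaneAdj e x y) : PathJoined e A x y :=
  Relation.ReflTransGen.single ⟨hx, hy, h⟩

theorem PathConn.of_forall_joined {e : ℤ} {A : Set Pt} (x : Pt)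
    (h : ∀ y ∈ A, PathJoined e A y x) : PathConn e A :=
  fun y hy z hz => (h y hy).trans (h z hz).symm

theorem pathJoined_row {e : ℤ} {A : Set Pt} {a b k : ℤ} (hab : a ≤ b)
    (h : ∀ t, a ≤ t → t ≤ b → (t, k) ∈ A) : PathJoined e A (a, k) (b, k) := by
  induction b, hab using Int.leInduction with
  | base => exact Relation.ReflTransGen.refl
  | succ b hab ih =>
    refine (ih fun t h1 h2 => h t h1 (by omega)).trans
      (pathJoined_of_adj (h _ hab (by omega)) (h _ (by omega) le_rfl) (Or.inl ?_))
    simp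

theorem pathJoined_col {e : ℤ} (he : 0 ≤ e) {A : Set Pt} {a b k : ℤ} (hab : a ≤ b)
    (h : ∀ t, a ≤ t → t ≤ b → (k, t) ∈ A) : PathJoined e A (k, a) (k, b) := by
  induction b, hab using Int.leInduction with
  | base => exact Relation.ReflTransGen.refl
  | succ b hab ih =>
    refine (ih fun t h1 h2 => h t h1 (by omega)).trans
      (pathJoined_of_adj (h _ hab (by omega)) (h _ (by omega) le_rfl) (Or.inr ?_))
    simp [he]

theorem AdjIndex.pathJoined {i : ℕ} {e : ℤ} (hi : AdjIndex i e) {A : Set Pt} {x y : Pt}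
    (h : ChainIn i A x y) : PathJoined e A x y := by
  obtain ⟨n, c, rfl, rfl, hA, hc⟩ := h
  have key : ∀ k ≤ n, PathJoined e A (c 0) (c k) := by
    intro k
    induction k with
    | zero => exact fun _ => Relation.ReflTransGen.refl
    | succ k ih =>
      exact fun hk => (ih (by omega)).trans (pathJoined_of_adj (hA _ (by omega)) (hA _ hk)
        ((hi.cAdj_iff _ _).1 (hc k (by omega))))
  exact key n le_rfl

theorem PathJoined.exists_boundary {e : ℤ} {A T : Set Pt} {x y : Pt} (h : PathJoined e A x y)
    (hx : x ∈ T) (hy : y ∉ T) : ∃ a ∈ T, ∃ b ∈ A, b ∉ T ∧ PlaneAdj e a b := by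
  induction h with
  | refl => exact absurd hx hy
  | @tail b c hb hbc ih =>
    by_cases hbT : b ∈ T
    · exact ⟨b, hbT, c, hbc.2.1, hy, hbc.2.2⟩
    · exact ih hbT

/-! ### Row components -/

/-- The open horizontal strip of row `k` between columns `p` and `q`. -/
def strip (k p q : ℤ) : Set Pt := {w | w.2 = k ∧ p < w.1 ∧ w.1 < q}

/-- The maximal horizontal segment of `Z` through `z`. -/
def rowComp (Z : Set Pt) (z : Pt) : Set Pt :=
  {w | w.2 = z.2 ∧ ∀ t, min w.1 z.1 ≤ t → t ≤ max w.1 z.1 → (t, z.2) ∈ Z}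

theorem self_mem_rowComp {Z : Set Pt} {z : Pt} (hz : z ∈ Z) : z ∈ rowComp Z z := by
  refine ⟨rfl, fun t h1 h2 => ?_⟩
  obtain rfl : t = z.1 := by omega
  exact hz

theorem rowComp_subset (Z : Set Pt) (z : Pt) : rowComp Z z ⊆ Z := by
  rintro ⟨x, y⟩ ⟨h, h'⟩
  obtain rfl : y = z.2 := h
  exact h' x (min_le_left _ _) (le_max_left _ _)

theorem mem_rowComp_comm {Z : Set Pt} {z w : Pt} : w ∈ rowComp Z z ↔ z ∈ rowComp Z w := by
  constructor <;> rintro ⟨h, h'⟩ <;> refine ⟨h.symm, fun t h1 h2 => ?_⟩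
  · rw [h]
    exact h' t (by omega) (by omega)
  · rw [h]
    exact h' t (by omega) (by omega)

theorem mem_rowComp_trans {Z : Set Pt} {x y z : Pt} (h : x ∈ rowComp Z y)
    (h' : y ∈ rowComp Z z) : x ∈ rowComp Z z := by
  refine ⟨h.1.trans h'.1, fun t h1 h2 => ?_⟩
  by_cases ht : min x.1 y.1 ≤ t ∧ t ≤ max x.1 y.1
  · rw [← h'.1]
    exact h.2 t ht.1 ht.2
  · exact h'.2 t (by omega) (by omega)

theorem rowComp_mono {Z Z' : Set Pt} (h : Z ⊆ Z') (z : Pt) : rowComp Z z ⊆ rowComp Z' z :=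
  fun _ hw => ⟨hw.1, fun t h1 h2 => h (hw.2 t h1 h2)⟩

theorem pathJoined_of_mem_rowComp {e : ℤ} {Z A : Set Pt} {z w : Pt} (hw : w ∈ rowComp Z z)
    (hA : rowComp Z z ⊆ A) : PathJoined e A w z := by
  obtain ⟨x, y⟩ := w
  obtain ⟨x', y'⟩ := z
  obtain ⟨hy, h⟩ := hw
  obtain rfl : y = y' := hy
  have hA' : ∀ t, min x x' ≤ t → t ≤ max x x' → (t, y) ∈ A := fun t h1 h2 =>
    hA ⟨rfl, fun s h3 h4 => h s (by dsimp only at *; omega) (by dsimp only at *; omega)⟩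
  rcases le_total x x' with hx | hx
  · exact pathJoined_row hx fun t h1 h2 => hA' t (by omega) (by omega)
  · exact (pathJoined_row hx fun t h1 h2 => hA' t (by omega) (by omega)).symm

theorem pathConn_rowComp {e : ℤ} {Z : Set Pt} {z : Pt} : PathConn e (rowComp Z z) :=
  .of_forall_joined z fun _ hw => pathJoined_of_mem_rowComp hw subset_rfl

/-- `T` is a union of row components of `Z`. -/
def RowSaturated (Z T : Set Pt) : Prop := ∀ c ∈ T, rowComp Z c ⊆ T

/-- `z` has points outside `Z` on both sides in its row. -/
def RowBounded (Z : Set Pt) (z : Pt) : Prop :=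
  (∃ a < z.1, (a, z.2) ∉ Z) ∧ ∃ b > z.1, (b, z.2) ∉ Z

theorem RowBounded.exists_strip {Z : Set Pt} {z : Pt} (hz : z ∈ Z) (h : RowBounded Z z) :
    ∃ p q, (p, z.2) ∉ Z ∧ (q, z.2) ∉ Z ∧ rowComp Z z = strip z.2 p q := by
  classical
  obtain ⟨⟨a, ha, haZ⟩, b, hb, hbZ⟩ := h
  obtain ⟨p, ⟨hp, hpZ⟩, hpmax⟩ := Int.exists_greatest_of_bdd
    (P := fun x => x < z.1 ∧ (x, z.2) ∉ Z) ⟨z.1, fun x hx => hx.1.le⟩ ⟨a, ha, haZ⟩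
  obtain ⟨q, ⟨hq, hqZ⟩, hqmin⟩ := Int.exists_least_of_bdd
    (P := fun x => z.1 < x ∧ (x, z.2) ∉ Z) ⟨z.1, fun x hx => hx.1.le⟩ ⟨b, hb, hbZ⟩
  refine ⟨p, q, hpZ, hqZ, Set.ext fun w => ⟨fun hw => ⟨hw.1, ?_, ?_⟩, fun hw => ⟨hw.1, ?_⟩⟩⟩
  · by_contra hlt
    exact hpZ (hw.2 p (by omega) (by omega))
  · by_contra hlt
    exact hqZ (hw.2 q (by omega) (by omega))
  · obtain ⟨-, h1, h2⟩ := hw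
    intro t h3 h4
    by_contra ht
    rcases lt_trichotomy t z.1 with h5 | rfl | h5
    · have := hpmax t ⟨h5, ht⟩
      omega
    · exact ht hz
    · have := hqmin t ⟨h5, ht⟩
      omega

/-- A connected set has a row component outside a given connected core whose removal leaves
a connected set. -/
theorem exists_removable_rowComp {e : ℤ} {Z : Set Pt} (hZ : PathConn e Z) :
    ∀ (n : ℕ) (T : Set Pt), (Z \ T).ncard = n → (Z \ T).Finite → T ⊆ Z → T ≠ Z → T.Nonempty →
      PathConn e T → RowSaturated Z T →
      ∃ z ∈ Z, T ⊆ Z \ rowComp Z z ∧ PathConn e (Z \ rowComp Z z) ∧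
        ∃ a ∈ rowComp Z z, ∃ u ∈ Z \ rowComp Z z, PlaneAdj e a u := by
  intro n
  induction n using Nat.strong_induction_on with
  | _ n ih =>
  intro T hn hfin hTZ hne hTne hT hsat
  obtain ⟨z', hz', hz'T⟩ := Set.exists_of_ssubset (hTZ.ssubset_of_ne hne)
  obtain ⟨c, hc⟩ := hTne
  obtain ⟨u, hu, z, hz, hzT, huz⟩ := (hZ c (hTZ hc) z' hz').exists_boundary hc hz'T
  have hdisj : ∀ w ∈ rowComp Z z, w ∉ T := fun w hw hwT =>
    hzT (hsat w hwT (mem_rowComp_comm.1 hw))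
  have hTsub : T ⊆ Z \ rowComp Z z := fun w hw => ⟨hTZ hw, fun h => hdisj w h hw⟩
  by_cases hcase : T ∪ rowComp Z z = Z
  · have hdiff : Z \ rowComp Z z = T := by
      refine subset_antisymm (fun w hw => ?_) hTsub
      rcases hcase.symm.subset hw.1 with h | h
      · exact h
      · exact absurd h hw.2
    exact ⟨z, hz, hTsub, hdiff.symm ▸ hT, z, self_mem_rowComp hz, u, hTsub hu, huz.symm⟩
  · have hss : Z \ (T ∪ rowComp Z z) ⊂ Z \ T :=
      ⟨Set.sdiff_subset_sdiff_right Set.subset_union_left,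
        fun h => (h ⟨hz, hzT⟩).2 (Or.inr (self_mem_rowComp hz))⟩
    obtain ⟨w, hw, h1, h2⟩ := ih _ (hn ▸ Set.ncard_lt_ncard hss hfin) (T ∪ rowComp Z z) rfl
      (hfin.subset hss.1) (Set.union_subset hTZ (rowComp_subset Z z)) hcase ⟨c, Or.inl hc⟩
      (.of_forall_joined u fun w hw => by
        rcases hw with hw | hw
        · exact (hT w hw u hu).mono Set.subset_union_left
        · exact (pathJoined_of_mem_rowComp hw Set.subset_union_right).trans
            (pathJoined_of_adj (Or.inr (self_mem_rowComp hz)) (Or.inl hu) huz.symm))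
      (fun w hw => by
        rcases hw with hw | hw
        · exact (hsat w hw).trans Set.subset_union_left
        · exact fun v hv => Or.inr (mem_rowComp_trans hv hw))
    exact ⟨w, hw, Set.subset_union_left.trans h1, h2⟩

/-! ### Crossing parity of closed paths -/

/-- Whether the step from `x` to `y` moves between the row of `w` and the row at signed
distance `σ`, with its endpoint in the row of `w` to the right of `w`. -/
def crossing (σ : ℤ) (w x y : Pt) : ZMod 2 :=
  if (x.2 = w.2 ∧ y.2 = w.2 + σ ∧ w.1 < x.1) ∨ (y.2 = w.2 ∧ x.2 = w.2 + σ ∧ w.1 < y.1)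
  then 1 else 0

/-- The parity of the crossings of a list of steps. -/
def crossings (σ : ℤ) (w : Pt) (L : List (Pt × Pt)) : ZMod 2 :=
  (L.map fun d => crossing σ w d.1 d.2).sum

/-- All steps of `L` are steps in `A`. -/
def StepsIn (e : ℤ) (A : Set Pt) (L : List (Pt × Pt)) : Prop :=
  ∀ d ∈ L, d.1 ∈ A ∧ d.2 ∈ A ∧ PlaneAdj e d.1 d.2

/-- The boundary of the chain `L`, modulo two, is `v - u`. -/
def HasBoundary (L : List (Pt × Pt)) (u v : Pt) : Prop :=
  ∀ f : Pt → ZMod 2, (L.map fun d => f d.2 - f d.1).sum = f v - f u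

theorem PathJoined.exists_steps {e : ℤ} {A : Set Pt} {u v : Pt} (h : PathJoined e A u v) :
    ∃ L, StepsIn e A L ∧ HasBoundary L u v := by
  induction h with
  | refl => exact ⟨[], by simp [StepsIn], by simp [HasBoundary]⟩
  | @tail b c _ hbc ih =>
    obtain ⟨L, h1, h2⟩ := ih
    refine ⟨(b, c) :: L, ?_, fun f => ?_⟩
    · intro d hd
      rcases List.mem_cons.1 hd with rfl | hd
      · exact hbc
      · exact h1 d hd
    · simp [h2 f]

theorem fst_ne_of_mem {Z : Set Pt} {w x : Pt} (hw : w ∉ Z) (hx : x ∈ Z) :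
    x.2 = w.2 → x.1 ≠ w.1 :=
  fun h1 h2 => hw (Prod.ext h2 h1 ▸ hx)

theorem crossing_eq_of_rows {σ : ℤ} {w w' x y : Pt} (hrow : w'.2 = w.2 + σ)
    (hxy : x.2 = w.2 → y.2 = w'.2 → (w.1 < x.1 ↔ w'.1 < y.1))
    (hyx : y.2 = w.2 → x.2 = w'.2 → (w.1 < y.1 ↔ w'.1 < x.1)) :
    crossing σ w x y = crossing (-σ) w' x y := by
  unfold crossing
  refine if_congr (Iff.trans ?_ or_comm) rfl rfl
  have hrow' : w'.2 + -σ = w.2 := by omega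
  rw [hrow', ← hrow]
  refine or_congr ⟨fun h => ⟨h.2.1, h.1, (hxy h.1 h.2.1).1 h.2.2⟩,
    fun h => ⟨h.2.1, h.1, (hxy h.2.1 h.1).2 h.2.2⟩⟩ ⟨fun h => ⟨h.2.1, h.1, (hyx h.1 h.2.1).1 h.2.2⟩,
    fun h => ⟨h.2.1, h.1, (hyx h.2.1 h.1).2 h.2.2⟩⟩

theorem crossing_add_crossing_neg {e : ℤ} (he : e ≤ 1) {Z : Set Pt} {w x y : Pt} (hw : w ∉ Z)
    (hx : x ∈ Z) (hy : y ∈ Z) (h : PlaneAdj e x y) :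
    crossing 1 w x y + crossing (-1) w x y =
      (if y.2 = w.2 ∧ w.1 < y.1 then 1 else 0) - if x.2 = w.2 ∧ w.1 < x.1 then 1 else 0 := by
  have hxw : x.2 = w.2 → x.1 ≠ w.1 := fst_ne_of_mem hw hx
  have hyw : y.2 = w.2 → y.1 ≠ w.1 := fst_ne_of_mem hw hy
  unfold crossing
  unfold PlaneAdj at h
  split_ifs <;> first | decide | (exfalso; omega)

theorem crossings_neg {e : ℤ} (he : e ≤ 1) {Z : Set Pt} {w u : Pt} (hw : w ∉ Z)
    {L : List (Pt × Pt)} (hL : StepsIn e Z L) (hc : HasBoundary L u u) :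
    crossings (-1) w L = crossings 1 w L := by
  have h : crossings 1 w L + crossings (-1) w L = 0 := by
    refine Eq.trans ?_
      ((hc fun x => if x.2 = w.2 ∧ w.1 < x.1 then (1 : ZMod 2) else 0).trans (sub_self _))
    rw [crossings, crossings, ← List.sum_map_add]
    exact congrArg _ (List.map_congr_left fun d hd =>
      crossing_add_crossing_neg he hw (hL d hd).1 (hL d hd).2.1 (hL d hd).2.2)
  exact (CharTwo.add_eq_zero.1 h).symm

theorem crossings_eq_of_adj {e e' : ℤ} (he : 0 ≤ e) (he' : 0 ≤ e') (hee : e + e' = 1) {Z : Set Pt}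
    {w w' u : Pt} (hw : w ∉ Z) (hw' : w' ∉ Z) (h : PlaneAdj e' w w') {L : List (Pt × Pt)}
    (hL : StepsIn e Z L) (hc : HasBoundary L u u) : crossings 1 w L = crossings 1 w' L := by
  have hstep : ∀ σ : ℤ, (σ = 1 ∨ σ = -1) → w'.2 = w.2 + σ →
      crossings σ w L = crossings (-σ) w' L := by
    intro σ hσ hrow
    refine congrArg _ (List.map_congr_left fun ⟨x, y⟩ hd => ?_)
    obtain ⟨hx, hy, hxy⟩ := hL _ hd
    have h1 : x.2 = w.2 → x.1 ≠ w.1 := fst_ne_of_mem hw hx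
    have h2 : y.2 = w.2 → y.1 ≠ w.1 := fst_ne_of_mem hw hy
    have h3 : x.2 = w'.2 → x.1 ≠ w'.1 := fst_ne_of_mem hw' hx
    have h4 : y.2 = w'.2 → y.1 ≠ w'.1 := fst_ne_of_mem hw' hy
    unfold PlaneAdj at h hxy
    dsimp only at *
    exact crossing_eq_of_rows hrow (by omega) (by omega)
  have hrow : w'.2 = w.2 ∨ w'.2 = w.2 + 1 ∨ w'.2 = w.2 + -1 := by
    unfold PlaneAdj at h
    omega
  rcases hrow with hrow | hrow | hrow
  · refine congrArg _ (List.map_congr_left fun ⟨x, y⟩ hd => ?_)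
    obtain ⟨hx, hy, hxy⟩ := hL _ hd
    have h1 : x.2 = w.2 → x.1 ≠ w.1 := fst_ne_of_mem hw hx
    have h2 : y.2 = w.2 → y.1 ≠ w.1 := fst_ne_of_mem hw hy
    have h3 : x.2 = w'.2 → x.1 ≠ w'.1 := fst_ne_of_mem hw' hx
    have h4 : y.2 = w'.2 → y.1 ≠ w'.1 := fst_ne_of_mem hw' hy
    unfold PlaneAdj at h
    dsimp only [crossing] at *
    split_ifs <;> first | rfl | (exfalso; omega)
  · rw [hstep 1 (Or.inl rfl) hrow, crossings_neg (by omega) hw' hL hc]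
  · rw [← crossings_neg (by omega) hw hL hc, hstep (-1) (Or.inr rfl) hrow, neg_neg]

theorem crossings_eq {e e' : ℤ} (he : 0 ≤ e) (he' : 0 ≤ e') (hee : e + e' = 1) {Z : Set Pt}
    (hZ : PathConn e' Zᶜ) {w w' u : Pt} (hw : w ∉ Z) (hw' : w' ∉ Z) {L : List (Pt × Pt)}
    (hL : StepsIn e Z L) (hc : HasBoundary L u u) {σ σ' : ℤ} (hσ : σ = 1 ∨ σ = -1)
    (hσ' : σ' = 1 ∨ σ' = -1) : crossings σ w L = crossings σ' w' L := by
  have key : crossings 1 w L = crossings 1 w' L := by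
    have h := hZ w hw w' hw'
    clear hw'
    induction h with
    | refl => rfl
    | tail _ hbc ih => exact ih.trans (crossings_eq_of_adj he he' hee hbc.1 hbc.2.1 hbc.2.2 hL hc)
  have h1 := crossings_neg (by omega) hw hL hc
  have h2 := crossings_neg (by omega) hw' hL hc
  rcases hσ with rfl | rfl <;> rcases hσ' with rfl | rfl <;> simp [h1, h2, key]

/-- Two neighbours of a bounded row component whose removal does not disconnect the set lie in
the same row and are not separated there. -/
theorem neighbors_strip {e e' : ℤ} (he : 0 ≤ e) (he' : 0 ≤ e') (hee : e + e' = 1) {Z : Set Pt}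
    (hZ : PathConn e' Zᶜ) {k p q : ℤ} (hS : strip k p q ⊆ Z) (hp : (p, k) ∉ Z) (hq : (q, k) ∉ Z)
    (hT : PathConn e (Z \ strip k p q)) {a b : ℤ} {u v : Pt} (hpa : p < a) (haq : a < q)
    (hpb : p < b) (hbq : b < q) (hu : u ∈ Z \ strip k p q) (hv : v ∈ Z \ strip k p q)
    (hau : PlaneAdj e (a, k) u) (hbv : PlaneAdj e (b, k) v) :
    (u.2 = k + 1 ∨ u.2 = k + -1) ∧ u.2 = v.2 ∧
      ∀ x, u.1 ≤ x → x ≤ v.1 → (x, u.2) ∈ Z := by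
  have hrow : ∀ {c : ℤ} {w : Pt}, p < c → c < q → w ∈ Z \ strip k p q → PlaneAdj e (c, k) w →
      w.2 = k + 1 ∨ w.2 = k + -1 := by
    rintro c w h1 h2 ⟨hw, hwS⟩ h
    have h3 : w.2 = k → w.1 ≠ p := fst_ne_of_mem hp hw
    have h4 : w.2 = k → w.1 ≠ q := fst_ne_of_mem hq hw
    have h5 : ¬ (w.2 = k ∧ p < w.1 ∧ w.1 < q) := hwS
    unfold PlaneAdj at h
    dsimp only at h
    omega
  obtain ⟨L, hL, hLb⟩ := (hT u hu v hv).exists_steps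
  have hstrip : ∀ t, p < t → t < q → (t, k) ∈ strip k p q := fun t h1 h2 => ⟨rfl, h1, h2⟩
  have hjoin : PathJoined e (strip k p q) (b, k) (a, k) := by
    rcases le_total a b with h | h
    · exact (pathJoined_row h fun t h1 h2 => hstrip t (by omega) (by omega)).symm
    · exact pathJoined_row h fun t h1 h2 => hstrip t (by omega) (by omega)
  obtain ⟨L', hL', hLb'⟩ := hjoin.exists_steps
  have haZ : (a, k) ∈ Z := hS ⟨rfl, hpa, haq⟩
  have hbZ : (b, k) ∈ Z := hS ⟨rfl, hpb, hbq⟩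
  set C : List (Pt × Pt) := (v, (b, k)) :: ((a, k), u) :: (L' ++ L) with hC
  have hCs : StepsIn e Z C := by
    intro d hd
    simp only [hC, List.mem_cons, List.mem_append] at hd
    rcases hd with rfl | rfl | hd | hd
    · exact ⟨hv.1, hbZ, hbv.symm⟩
    · exact ⟨haZ, hu.1, hau⟩
    · exact ⟨hS (hL' d hd).1, hS (hL' d hd).2.1, (hL' d hd).2.2⟩
    · exact ⟨(hL d hd).1.1, (hL d hd).2.1.1, (hL d hd).2.2⟩
  have hCb : HasBoundary C v v := by
    intro f
    simp only [hC, List.map_cons, List.map_append, List.sum_cons, List.sum_append, hLb f, hLb' f]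
    ring
  have hCc : ∀ σ : ℤ, (σ = 1 ∨ σ = -1) → ∀ w, crossings σ w C =
      crossing σ w v (b, k) + (crossing σ w (a, k) u + crossings σ w L) := by
    intro σ hσ w
    have h0 : crossings σ w L' = 0 := by
      refine List.sum_eq_zero fun x hx => ?_
      obtain ⟨d, hd, rfl⟩ := List.mem_map.1 hx
      have h1 := (hL' d hd).1.1
      have h2 := (hL' d hd).2.1.1
      unfold crossing
      rw [if_neg (by omega)]
    have h1 : crossings σ w C =
        crossing σ w v (b, k) + (crossing σ w (a, k) u + (crossings σ w L' + crossings σ w L)) := by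
      simp only [hC, crossings, List.map_cons, List.map_append, List.sum_cons, List.sum_append]
    rw [h1, h0, zero_add]
  have hcol : ∀ d ∈ L, (d.1.2 = k → d.1.1 < p ∨ q < d.1.1) ∧
      (d.2.2 = k → d.2.1 < p ∨ q < d.2.1) := by
    have h : ∀ w ∈ Z \ strip k p q, w.2 = k → w.1 < p ∨ q < w.1 := by
      rintro w ⟨hw, hwS⟩ hk
      have h3 : w.1 ≠ p := fst_ne_of_mem hp hw hk
      have h4 : w.1 ≠ q := fst_ne_of_mem hq hw hk
      have h5 : ¬ (w.2 = k ∧ p < w.1 ∧ w.1 < q) := hwS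
      omega
    exact fun d hd => ⟨h _ (hL d hd).1, h _ (hL d hd).2.1⟩
  clear_value C
  have hur := hrow hpa haq hu hau
  have hvr := hrow hpb hbq hv hbv
  have huv : u.2 = v.2 := by
    by_contra hne
    have h := crossings_eq he he' hee hZ hp hq hCs hCb (Or.inl rfl) (Or.inl rfl)
    have hLeq : crossings 1 (p, k) L = crossings 1 (q, k) L := by
      refine congrArg _ (List.map_congr_left fun d hd => ?_)
      have := hcol d hd
      unfold crossing
      dsimp only
      split_ifs <;> first | rfl | (exfalso; omega)
    rw [hCc 1 (Or.inl rfl), hCc 1 (Or.inl rfl), hLeq, ← add_assoc, ← add_assoc] at h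
    replace h := add_right_cancel h
    unfold crossing at h
    dsimp only at h
    split_ifs at h <;> first | exact absurd h (by decide) | omega
  refine ⟨hur, huv, fun x h1 h2 => ?_⟩
  by_contra hx
  obtain ⟨σ, hσ, hσu⟩ : ∃ σ : ℤ, (σ = 1 ∨ σ = -1) ∧ u.2 = k + σ := by
    rcases hur with h | h
    exacts [⟨1, Or.inl rfl, h⟩, ⟨-1, Or.inr rfl, h⟩]
  have hσ' : -σ = 1 ∨ -σ = -1 := by omega
  have hxu : x ≠ u.1 := by
    rintro rfl
    exact hx hu.1
  have hxv : x ≠ v.1 := by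
    rintro rfl
    exact hx (huv ▸ hv.1)
  have h := crossings_eq he he' hee hZ hx hq hCs hCb hσ' hσ
  have hLeq : crossings (-σ) (x, u.2) L = crossings σ (q, k) L := by
    refine congrArg _ (List.map_congr_left fun d hd => ?_)
    have h3 := hcol d hd
    have h4 : d.1.2 = u.2 → d.1.1 ≠ x := fst_ne_of_mem hx (hL d hd).1.1
    have h5 : d.2.2 = u.2 → d.2.1 ≠ x := fst_ne_of_mem hx (hL d hd).2.1.1
    have h6 := (hL d hd).2.2
    unfold PlaneAdj at h6 hau hbv
    dsimp only at h3 h4 h5 h6 hau hbv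
    exact (crossing_eq_of_rows (w := (q, k)) (w' := (x, u.2)) hσu (by dsimp only; omega)
      (by dsimp only; omega)).symm
  rw [hCc _ hσ', hCc _ hσ, hLeq, ← add_assoc, ← add_assoc] at h
  replace h := add_right_cancel h
  unfold crossing at h
  dsimp only at h
  split_ifs at h <;> first | exact absurd h (by decide) | omega

/-! ### Homotopy equivalences -/

theorem natAdj.eq_or_succ_eq {s t : ℕ} (h : natAdj s t) : s = t ∨ s + 1 = t ∨ t + 1 = s := h

theorem Homotopic.of_eq {i : ℕ} {α β : Type} {κ : α → α → Prop} {δ : β → β → Prop} {f g : α → β}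
    (hδ : ∀ y, δ y y) (hf : DigCont κ δ f) (h : ∀ x, f x = g x) : Homotopic i κ δ f g := by
  refine ⟨0, fun x _ => f x, fun _ => rfl, h, fun x y s t _ _ hxy => ?_⟩
  unfold prodAdj at hxy
  split_ifs at hxy
  · rcases hxy with hxy | hxy
    · exact hf _ _ hxy.1
    · have : x = y := hxy.1
      exact this ▸ hδ _
  · exact hf _ _ hxy.1

theorem Homotopic.comp_left {i : ℕ} {α β γ : Type} {κ : α → α → Prop} {δ : β → β → Prop}
    {ε : γ → γ → Prop} {f f' : α → β} (h : Homotopic i κ δ f f') {g : β → γ}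
    (hg : DigCont δ ε g) : Homotopic i κ ε (g ∘ f) (g ∘ f') := by
  obtain ⟨m, H, h0, hm, hc⟩ := h
  exact ⟨m, fun x t => g (H x t), fun x => congrArg g (h0 x), fun x => congrArg g (hm x),
    fun x y s t hs ht hxy => hg _ _ (hc x y s t hs ht hxy)⟩

theorem Homotopic.comp_right {i : ℕ} {α β γ : Type} {κ : α → α → Prop} {δ : β → β → Prop}
    {ε : γ → γ → Prop} {g g' : β → γ} (h : Homotopic i δ ε g g') {f : α → β}
    (hf : DigCont κ δ f) : Homotopic i κ ε (g ∘ f) (g' ∘ f) := by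
  obtain ⟨m, H, h0, hm, hc⟩ := h
  refine ⟨m, fun x t => H (f x) t, fun x => h0 _, fun x => hm _,
    fun x y s t hs ht hxy => hc _ _ s t hs ht ?_⟩
  unfold prodAdj at *
  split_ifs at *
  · exact hxy.imp (fun h => ⟨hf _ _ h.1, h.2⟩) fun h => ⟨congrArg f h.1, h.2⟩
  · exact ⟨hf _ _ hxy.1, hxy.2⟩

theorem prodAdj_shift {i : ℕ} {α : Type} {κ : α → α → Prop} {x y : α} {s t s' t' : ℕ}
    (h : prodAdj i κ (x, s) (y, t)) (h1 : s = t → s' = t') (h2 : natAdj s t → natAdj s' t') :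
    prodAdj i κ (x, s') (y, t') := by
  unfold prodAdj at *
  split_ifs at *
  · exact h.imp (fun h => ⟨h.1, h1 h.2⟩) fun h => ⟨h.1, h2 h.2⟩
  · exact ⟨h.1, h2 h.2⟩

theorem prodAdj.natAdj {i : ℕ} {α : Type} {κ : α → α → Prop} {x y : α} {s t : ℕ}
    (h : prodAdj i κ (x, s) (y, t)) : natAdj s t := by
  unfold prodAdj at h
  split_ifs at h
  · exact h.elim (fun h => Or.inl h.2) fun h => h.2
  · exact h.2

theorem Homotopic.trans {i : ℕ} {α β : Type} {κ : α → α → Prop} {δ : β → β → Prop}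
    {f g h : α → β} (hfg : Homotopic i κ δ f g) (hgh : Homotopic i κ δ g h) :
    Homotopic i κ δ f h := by
  obtain ⟨m, H, h0, hm, hc⟩ := hfg
  obtain ⟨n, K, k0, kn, kc⟩ := hgh
  have hK : ∀ x t, m ≤ t → (if t ≤ m then H x t else K x (t - m)) = K x (t - m) := by
    intro x t ht
    split_ifs with h
    · obtain rfl : t = m := le_antisymm h ht
      rw [hm, Nat.sub_self, k0]
    · rfl
  refine ⟨m + n, fun x t => if t ≤ m then H x t else K x (t - m), fun x => ?_, fun x => ?_,
    fun x y s t hs ht hxy => ?_⟩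
  · exact (if_pos (Nat.zero_le m)).trans (h0 x)
  · refine (hK x (m + n) (by omega)).trans ?_
    rw [Nat.add_sub_cancel_left, kn]
  · have hst := hxy.natAdj.eq_or_succ_eq
    dsimp only
    by_cases hle : s ≤ m ∧ t ≤ m
    · rw [if_pos hle.1, if_pos hle.2]
      exact hc x y s t hle.1 hle.2 hxy
    · rw [hK x s (by omega), hK y t (by omega)]
      refine kc x y _ _ (by omega) (by omega) (prodAdj_shift hxy (by omega) fun _ => ?_)
      unfold _root_.natAdj
      omega

theorem HtpyEquiv.symm {i : ℕ} {α β : Type} {κ : α → α → Prop} {δ : β → β → Prop}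
    (h : HtpyEquiv i κ δ) : HtpyEquiv i δ κ := by
  obtain ⟨f, g, hf, hg, h1, h2⟩ := h
  exact ⟨g, f, hg, hf, h2, h1⟩

theorem HtpyEquiv.trans {i : ℕ} {α β γ : Type} {κ : α → α → Prop} {δ : β → β → Prop}
    {ε : γ → γ → Prop} (h : HtpyEquiv i κ δ) (h' : HtpyEquiv i δ ε) : HtpyEquiv i κ ε := by
  obtain ⟨f, g, hf, hg, h1, h2⟩ := h
  obtain ⟨f', g', hf', hg', h1', h2'⟩ := h'
  exact ⟨f' ∘ f, g ∘ g', fun x y h => hf' _ _ (hf _ _ h), fun x y h => hg _ _ (hg' _ _ h),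
    ((h1'.comp_left hg).comp_right hf).trans h1, ((h2.comp_left hf').comp_right hg').trans h2'⟩

theorem AdjIndex.subAdj_refl {i : ℕ} {e : ℤ} (hi : AdjIndex i e) {Z : Set Pt} (x : Z) :
    subAdj i Z x x := by
  refine (hi.cAdj_iff _ _).2 (Or.inl ?_)
  simp

theorem AdjIndex.htpyEquiv_refl {i : ℕ} {e : ℤ} (hi : AdjIndex i e) (Z : Set Pt) :
    HtpyEquiv i (subAdj i Z) (subAdj i Z) :=
  ⟨id, id, fun _ _ h => h, fun _ _ h => h, .of_eq hi.subAdj_refl (fun _ _ h => h) fun _ => rfl,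
    .of_eq hi.subAdj_refl (fun _ _ h => h) fun _ => rfl⟩

/-- A deformation `h` of `Z`, running backwards in time from a retraction onto `T` to the
identity, gives a homotopy equivalence. -/
theorem AdjIndex.htpyEquiv_of_deformation {i : ℕ} {e : ℤ} (hi : AdjIndex i e) {Z T : Set Pt}
    (hTZ : T ⊆ Z) (h : Pt → ℕ → Pt) (m : ℕ) (h0 : ∀ z ∈ Z, h z 0 ∈ T) (hT : ∀ z ∈ T, h z 0 = z)
    (hm : ∀ z ∈ Z, h z m = z) (hZ : ∀ z ∈ Z, ∀ t, h z t ∈ Z)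
    (hc : ∀ z ∈ Z, ∀ w ∈ Z, PlaneAdj e z w → ∀ s t, natAdj s t → (e = 1 ∨ s = t ∨ z = w) →
      PlaneAdj e (h z s) (h w t)) : HtpyEquiv i (subAdj i Z) (subAdj i T) := by
  refine ⟨fun z => ⟨h z.1 0, h0 z z.2⟩, fun z => ⟨z.1, hTZ z.2⟩, fun z w hzw => ?_,
    fun z w hzw => hzw, ⟨m, fun z t => ⟨h z.1 t, hZ z z.2 t⟩, fun z => rfl,
      fun z => Subtype.ext (hm z z.2), fun z w s t _ _ hzw => ?_⟩, ?_⟩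
  · exact (hi.cAdj_iff _ _).2
      (hc z z.2 w w.2 ((hi.cAdj_iff _ _).1 hzw) 0 0 (Or.inl rfl) (Or.inr (Or.inl rfl)))
  · refine (hi.cAdj_iff _ _).2 (hc z z.2 w w.2 ?_ s t hzw.natAdj ?_)
    · unfold prodAdj at hzw
      split_ifs at hzw
      · rcases hzw with hzw | hzw
        · exact (hi.cAdj_iff _ _).1 hzw.1
        · have hzw' : z = w := hzw.1
          exact hzw' ▸ (hi.cAdj_iff _ _).1 (hi.subAdj_refl z)
      · exact (hi.cAdj_iff _ _).1 hzw.1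
    · rcases hi with ⟨rfl, rfl⟩ | ⟨rfl, rfl⟩
      · rcases hzw with hzw | hzw
        · exact Or.inr (Or.inl hzw.2)
        · exact Or.inr (Or.inr (congrArg Subtype.val hzw.1))
      · exact Or.inl rfl
  · refine .of_eq hi.subAdj_refl (fun z w hzw => ?_) fun z => Subtype.ext (hT z z.2)
    refine (hi.cAdj_iff _ _).2 ?_
    change PlaneAdj e (h z.1 0) (h w.1 0)
    rw [hT z z.2, hT w w.2]
    exact (hi.cAdj_iff _ _).1 hzw

/-- A strip all of whose neighbours form a segment in one adjacent row can be folded away. -/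
theorem AdjIndex.htpyEquiv_fold {i : ℕ} {e : ℤ} (hi : AdjIndex i e) {Z : Set Pt}
    {k p q u v σ a b : ℤ} (hσ : σ = 1 ∨ σ = -1) (hS : strip k p q ⊆ Z) (huv : u ≤ v)
    (hI : ∀ x, u ≤ x → x ≤ v → (x, k + σ) ∈ Z)
    (ha : p < a ∧ a < q ∧ -e ≤ a - u ∧ a - u ≤ e) (hb : p < b ∧ b < q ∧ -e ≤ b - v ∧ b - v ≤ e)
    (hnb : ∀ c w, p < c → c < q → w ∈ Z → PlaneAdj e (c, k) w →
      w ∈ strip k p q ∨ (w.2 = k + σ ∧ u ≤ w.1 ∧ w.1 ≤ v)) :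
    HtpyEquiv i (subAdj i Z) (subAdj i (Z \ strip k p q)) := by
  classical
  have he := hi.bounds
  obtain ⟨N, hN⟩ : ∃ N : ℕ, u - N ≤ p ∧ q ≤ v + N :=
    ⟨(max (u - p) (q - v)).toNat, by omega, by omega⟩
  let h : Pt → ℕ → Pt := fun w t => if w ∈ strip k p q then
    (if t = 0 then (max u (min v w.1), k + σ)
      else (max (u - e - (t - 1)) (min (v + e + (t - 1)) w.1), k)) else w
  have h_zero : ∀ w ∈ strip k p q, h w 0 = (max u (min v w.1), k + σ) := fun w hw => by
    simp only [h, if_pos hw, if_true]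
  have h_pos : ∀ w ∈ strip k p q, ∀ t : ℕ, t ≠ 0 →
      h w t = (max (u - e - (t - 1)) (min (v + e + (t - 1)) w.1), k) := fun w hw t ht => by
    simp only [h, if_pos hw, if_neg ht]
  have h_not : ∀ w, w ∉ strip k p q → ∀ t, h w t = w := fun w hw t => by
    simp only [h, if_neg hw]
  have h0 : ∀ z ∈ Z, h z 0 ∈ Z \ strip k p q := by
    intro z hz
    by_cases hzS : z ∈ strip k p q
    · rw [h_zero z hzS]
      refine ⟨hI _ (by omega) (by omega), fun hmem => ?_⟩
      have : k + σ = k := hmem.1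
      omega
    · rw [h_not z hzS]
      exact ⟨hz, hzS⟩
  refine hi.htpyEquiv_of_deformation Set.sdiff_subset h (N + 1) h0 (fun z hz => h_not z hz.2 0)
    (fun z _ => ?_) (fun z hz t => ?_) fun z hz w hw hzw s t hst hcase => ?_
  · by_cases hzS : z ∈ strip k p q
    · rw [h_pos z hzS _ (Nat.succ_ne_zero N)]
      obtain ⟨h1, h2, h3⟩ := hzS
      refine Prod.ext ?_ h1.symm
      push_cast
      omega
    · exact h_not z hzS _
  · by_cases hzS : z ∈ strip k p q
    · rcases Nat.eq_zero_or_pos t with rfl | ht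
      · exact (h0 z hz).1
      · rw [h_pos z hzS t ht.ne']
        obtain ⟨h1, h2, h3⟩ := hzS
        exact hS ⟨rfl, by dsimp only; omega, by dsimp only; omega⟩
    · rw [h_not z hzS]
      exact hz
  · have hst' := hst.eq_or_succ_eq
    by_cases hzS : z ∈ strip k p q <;> by_cases hwS : w ∈ strip k p q
    · have hz' := hzS
      have hw' := hwS
      obtain ⟨hz1, hz2, hz3⟩ := hz'
      obtain ⟨hw1, hw2, hw3⟩ := hw'
      have hcase' : e = 1 ∨ s = t ∨ z.1 = w.1 := hcase.imp_right (Or.imp_right (congrArg Prod.fst))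
      unfold PlaneAdj at hzw ⊢
      rcases Nat.eq_zero_or_pos s with rfl | hs <;> rcases Nat.eq_zero_or_pos t with rfl | ht
      · rw [h_zero z hzS, h_zero w hwS]
        dsimp only
        omega
      · rw [h_zero z hzS, h_pos w hwS t ht.ne']
        dsimp only
        omega
      · rw [h_pos z hzS s hs.ne', h_zero w hwS]
        dsimp only
        omega
      · rw [h_pos z hzS s hs.ne', h_pos w hwS t ht.ne']
        dsimp only
        omega
    · obtain ⟨hz1, hz2, hz3⟩ := id hzS
      have hadj : PlaneAdj e (z.1, k) w := by rwa [← hz1]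
      have hn := (hnb z.1 w hz2 hz3 hw hadj).resolve_left hwS
      rw [h_not w hwS]
      unfold PlaneAdj at hzw ⊢
      rcases Nat.eq_zero_or_pos s with rfl | hs
      · rw [h_zero z hzS]
        dsimp only
        omega
      · rw [h_pos z hzS s hs.ne']
        dsimp only
        omega
    · obtain ⟨hz1, hz2, hz3⟩ := id hwS
      have hadj : PlaneAdj e (w.1, k) z := by
        rw [← hz1]
        exact hzw.symm
      have hn := (hnb w.1 z hz2 hz3 hz hadj).resolve_left hzS
      rw [h_not z hzS]
      unfold PlaneAdj at hzw ⊢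
      rcases Nat.eq_zero_or_pos t with rfl | ht
      · rw [h_zero w hwS]
        dsimp only
        omega
      · rw [h_pos w hwS t ht.ne']
        dsimp only
        omega
    · rw [h_not z hzS, h_not w hwS]
      exact hzw

/-- A connected set with connected complement is homotopy equivalent to a connected row-saturated
core, provided only finitely many points, lying in bounded row components, are outside the core. -/
theorem AdjIndex.htpyEquiv_core {i : ℕ} {e e' : ℤ} (hi : AdjIndex i e) (he' : 0 ≤ e')
    (hee : e + e' = 1) {core : Set Pt} (hne : core.Nonempty) (hcore : PathConn e core) :
    ∀ (n : ℕ) (Z : Set Pt), (Z \ core).ncard = n → (Z \ core).Finite → core ⊆ Z →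
      RowSaturated Z core → PathConn e Z → PathConn e' Zᶜ →
      (∀ z ∈ Z \ core, RowBounded Z z) → HtpyEquiv i (subAdj i Z) (subAdj i core) := by
  classical
  intro n
  induction n using Nat.strong_induction_on with
  | _ n ih =>
  intro Z hn hfin hcZ hsat hZ hZc hbd
  by_cases hZeq : core = Z
  · subst hZeq
    exact hi.htpyEquiv_refl core
  obtain ⟨z, hz, hcT, hT, a₀, ha₀, u₀, hu₀, hau₀⟩ :=
    exists_removable_rowComp hZ _ core rfl hfin hcZ hZeq hne hcore hsat
  have hzc : z ∉ core := fun h => (hcT h).2 (self_mem_rowComp hz)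
  obtain ⟨p, q, hp, hq, hstrip⟩ := (hbd z ⟨hz, hzc⟩).exists_strip hz
  have hSZ : rowComp Z z ⊆ Z := rowComp_subset Z z
  have hzS : z ∈ rowComp Z z := self_mem_rowComp hz
  rw [hstrip] at hcT hT ha₀ hu₀ hSZ hzS
  generalize z.2 = k at *
  have hTc : PathConn e' (Z \ strip k p q)ᶜ := by
    have hsub : Zᶜ ⊆ (Z \ strip k p q)ᶜ := fun w hw hw' => hw hw'.1
    refine .of_forall_joined (p, k) fun w hw => ?_
    by_cases hwZ : w ∈ Z
    · obtain ⟨x, y⟩ := w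
      obtain ⟨hwy, hwp, -⟩ : (x, y) ∈ strip k p q := by
        by_contra hwS
        exact hw ⟨hwZ, hwS⟩
      obtain rfl : y = k := hwy
      refine (pathJoined_row (le_of_lt hwp) fun t h1 h2 => ?_).symm
      rcases h1.eq_or_lt with rfl | h1
      · exact hsub hp
      · refine fun hmem => hmem.2 ⟨rfl, h1, lt_of_le_of_lt h2 ?_⟩
        by_contra hqx
        exact hw ⟨hwZ, fun hS => hqx hS.2.2⟩
    · exact (hZc w hwZ _ hp).mono hsub
  have hss : (Z \ strip k p q) \ core ⊂ Z \ core :=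
    ⟨fun w hw => ⟨hw.1.1, hw.2⟩, fun h => (h ⟨hz, hzc⟩).1.2 hzS⟩
  have hfold : HtpyEquiv i (subAdj i Z) (subAdj i (Z \ strip k p q)) := by
    have hleaf := @neighbors_strip e e' hi.bounds.1 he' hee Z hZc k p q hSZ hp hq hT
    obtain ⟨x₀, y₀⟩ := a₀
    obtain ⟨rfl, hpx₀, hx₀q⟩ : y₀ = k ∧ p < x₀ ∧ x₀ < q := ha₀
    obtain ⟨σ, hσ, hσu⟩ : ∃ σ : ℤ, (σ = 1 ∨ σ = -1) ∧ u₀.2 = y₀ + σ := by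
      rcases (hleaf hpx₀ hx₀q hpx₀ hx₀q hu₀ hu₀ hau₀ hau₀).1 with h | h
      exacts [⟨1, Or.inl rfl, h⟩, ⟨-1, Or.inr rfl, h⟩]
    let P : ℤ → Prop := fun x => ∃ c, p < c ∧ c < q ∧ (x, y₀ + σ) ∈ Z \ strip y₀ p q ∧
      PlaneAdj e (c, y₀) (x, y₀ + σ)
    have hP₀ : P u₀.1 := ⟨x₀, hpx₀, hx₀q, by rwa [← hσu], by rwa [← hσu]⟩
    have he := hi.bounds
    have hdist : ∀ {c x : ℤ}, PlaneAdj e (c, y₀) (x, y₀ + σ) → -e ≤ c - x ∧ c - x ≤ e := by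
      intro c x h
      unfold PlaneAdj at h
      dsimp only at h
      omega
    obtain ⟨u, ⟨a, hpa, haq, huZ, hau⟩, humin⟩ := Int.exists_least_of_bdd (P := P)
      ⟨p - 1, fun x ⟨c, h1, _, _, h4⟩ => by have := hdist h4; omega⟩ ⟨_, hP₀⟩
    obtain ⟨v, ⟨b, hpb, hbq, hvZ, hbv⟩, hvmax⟩ := Int.exists_greatest_of_bdd (P := P)
      ⟨q + 1, fun x ⟨c, _, h2, _, h4⟩ => by have := hdist h4; omega⟩ ⟨_, hP₀⟩
    refine hi.htpyEquiv_fold hσ hSZ (u := u) (v := v) ((humin _ hP₀).trans (hvmax _ hP₀))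
      (hleaf hpa haq hpb hbq huZ hvZ hau hbv).2.2 ⟨hpa, haq, hdist hau⟩ ⟨hpb, hbq, hdist hbv⟩
      fun c w hpc hcq hw hcw => ?_
    by_cases hwS : w ∈ strip y₀ p q
    · exact Or.inl hwS
    · obtain ⟨x, y⟩ := w
      obtain rfl : y₀ + σ = y :=
        hσu.symm.trans (hleaf hpx₀ hx₀q hpc hcq hu₀ ⟨hw, hwS⟩ hau₀ hcw).2.1
      have hPx : P x := ⟨c, hpc, hcq, ⟨hw, hwS⟩, hcw⟩
      exact Or.inr ⟨rfl, humin x hPx, hvmax x hPx⟩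
  refine hfold.trans (ih _ (hn ▸ Set.ncard_lt_ncard hss hfin) _ rfl (hfin.subset hss.1) hcT
    (fun c hc => (rowComp_mono Set.sdiff_subset c).trans (hsat c hc)) hT hTc fun w hw => ?_)
  obtain ⟨⟨x, hx, hxZ⟩, y, hy, hyZ⟩ := hbd w (hss.1 hw)
  exact ⟨⟨x, hx, fun h => hxZ h.1⟩, y, hy, fun h => hyZ h.1⟩

/-! ### Finite sets and row-convex hulls -/

theorem Set.Finite.exists_box {X : Set Pt} (hX : X.Finite) :
    ∃ M : ℤ, ∀ w ∈ X, -M < w.1 ∧ w.1 < M ∧ -M < w.2 ∧ w.2 < M := by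
  induction X, hX using Set.Finite.induction_on with
  | empty => exact ⟨0, by simp⟩
  | @insert a s _ _ ih =>
    obtain ⟨M, hM⟩ := ih
    refine ⟨max M (max (max a.1 (-a.1)) (max a.2 (-a.2)) + 1), fun w hw => ?_⟩
    rcases hw with rfl | hw
    · omega
    · have := hM w hw
      omega

theorem Set.Finite.rowBounded {X : Set Pt} (hX : X.Finite) (z : Pt) : RowBounded X z := by
  obtain ⟨M, hM⟩ := hX.exists_box
  refine ⟨⟨min (z.1 - 1) (-M), by omega, fun h => ?_⟩, max (z.1 + 1) M, by omega, fun h => ?_⟩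
  · have := hM _ h
    dsimp only at this
    omega
  · have := hM _ h
    dsimp only at this
    omega

/-- A segment of a row is contractible. -/
theorem AdjIndex.htpyEquiv_point {i : ℕ} {e : ℤ} (hi : AdjIndex i e) {X : Set Pt} (hX : X.Finite)
    {z : Pt} (hz : z ∈ X) : HtpyEquiv i (subAdj i (rowComp X z)) (subAdj i ({z} : Set Pt)) := by
  obtain ⟨M, hM⟩ := hX.exists_box
  have hMz := hM z hz
  have hbox : ∀ w ∈ rowComp X z, -M < w.1 ∧ w.1 < M := fun w hw => by
    have := hM w (rowComp_subset X z hw)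
    omega
  obtain ⟨N, hN⟩ : ∃ N : ℕ, 2 * M ≤ N := ⟨(2 * M).toNat, by omega⟩
  refine hi.htpyEquiv_of_deformation (Set.singleton_subset_iff.2 (self_mem_rowComp hz))
    (fun w t => (max (z.1 - t) (min (z.1 + t) w.1), z.2)) N (fun w _ => ?_) (fun w hw => ?_)
    (fun w hw => ?_) (fun w hw t => ?_) fun w hw w' hw' hadj s t hst hcase => ?_
  · exact Prod.ext (by push_cast; omega) rfl
  · obtain rfl : w = z := hw
    exact Prod.ext (by push_cast; omega) rfl
  · have := hbox w hw
    exact Prod.ext (by dsimp only; omega) hw.1.symm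
  · refine ⟨rfl, fun x h1 h2 => hw.2 x ?_ ?_⟩
    · dsimp only at h1
      omega
    · dsimp only at h2
      omega
  · have hst' := hst.eq_or_succ_eq
    have hcase' : e = 1 ∨ s = t ∨ w.1 = w'.1 := hcase.imp_right (Or.imp_right (congrArg Prod.fst))
    have he := hi.bounds
    unfold PlaneAdj at hadj ⊢
    dsimp only
    omega

theorem mem_Hr_iff {X : Set Pt} {w : Pt} :
    w ∈ Hr X ↔ (∃ a ≤ w.1, (a, w.2) ∈ X) ∧ ∃ c ≥ w.1, (c, w.2) ∈ X := by
  constructor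
  · intro h
    refine h {w | (∃ a ≤ w.1, (a, w.2) ∈ X) ∧ ∃ c ≥ w.1, (c, w.2) ∈ X} ⟨?_, fun w hw => ?_⟩
    · rintro a b c k ⟨⟨a', h1, h2⟩, -⟩ ⟨-, c', h3, h4⟩ hab hbc
      exact ⟨⟨a', h1.trans hab, h2⟩, c', hbc.trans h3, h4⟩
    · exact ⟨⟨w.1, le_rfl, hw⟩, w.1, le_rfl, hw⟩
  · rintro ⟨⟨a, h1, h2⟩, c, h3, h4⟩ S ⟨hS, hXS⟩
    exact hS a w.1 c w.2 (hXS h2) (hXS h4) h1 h3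

theorem subset_Hr (X : Set Pt) : X ⊆ Hr X := fun _ hw _ hS => hS.2 hw

theorem finite_Hr {X : Set Pt} (hX : X.Finite) : (Hr X).Finite := by
  obtain ⟨M, hM⟩ := hX.exists_box
  refine (Set.finite_Icc ((-M, -M) : Pt) (M, M)).subset fun w hw => ?_
  obtain ⟨⟨a, h1, h2⟩, c, h3, h4⟩ := mem_Hr_iff.1 hw
  have h5 := hM _ h2
  have h6 := hM _ h4
  dsimp only at h5 h6
  exact ⟨⟨by dsimp only; omega, by dsimp only; omega⟩, by dsimp only; omega, by dsimp only; omega⟩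

theorem pathConn_Hr {e : ℤ} {X : Set Pt} (hX : PathConn e X) (hne : X.Nonempty) :
    PathConn e (Hr X) := by
  obtain ⟨x, hx⟩ := hne
  refine .of_forall_joined x fun w hw => ?_
  obtain ⟨⟨a, h1, h2⟩, c, h3, h4⟩ := mem_Hr_iff.1 hw
  exact (pathJoined_row h1 fun t h5 h6 => mem_Hr_iff.2 ⟨⟨a, h5, h2⟩, c, h6.trans h3, h4⟩).symm.trans
    ((hX _ h2 x hx).mono (subset_Hr X))

theorem pathConn_compl_Hr {e : ℤ} (he : 0 ≤ e) {X : Set Pt} (hX : X.Finite) :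
    PathConn e (Hr X)ᶜ := by
  obtain ⟨M, hM⟩ := (finite_Hr hX).exists_box
  have hout : ∀ x y : ℤ, (x ≤ -M ∨ M ≤ x ∨ M ≤ y) → (x, y) ∈ (Hr X)ᶜ := fun x y h hw => by
    have := hM _ hw
    dsimp only at this
    omega
  have hcol : ∀ x y : ℤ, (x ≤ -M ∨ M ≤ x) → PathJoined e (Hr X)ᶜ (x, y) (x, M) := fun x y h => by
    rcases le_total y M with hy | hy
    · exact pathJoined_col he hy fun t _ _ => hout x t (by omega)
    · exact (pathJoined_col he hy fun t _ _ => hout x t (by omega)).symm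
  have htop : ∀ x : ℤ, PathJoined e (Hr X)ᶜ (x, M) (0, M) := fun x => by
    rcases le_total x 0 with hx | hx
    · exact pathJoined_row hx fun t _ _ => hout t M (by omega)
    · exact (pathJoined_row hx fun t _ _ => hout t M (by omega)).symm
  refine .of_forall_joined (0, M) fun w hw => ?_
  by_cases hl : ∃ a ≤ w.1, (a, w.2) ∈ X
  · have hr : ∀ c ≥ w.1, (c, w.2) ∉ X := fun c h1 h2 => hw (mem_Hr_iff.2 ⟨hl, c, h1, h2⟩)
    have hray : PathJoined e (Hr X)ᶜ w (max w.1 M, w.2) :=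
      pathJoined_row (le_max_left _ _) fun t h1 _ h2 => by
        obtain ⟨-, c, h3, h4⟩ := mem_Hr_iff.1 h2
        exact hr c (h1.trans h3) h4
    exact hray.trans ((hcol _ _ (by omega)).trans (htop _))
  · have hray : PathJoined e (Hr X)ᶜ (min w.1 (-M), w.2) w :=
      pathJoined_row (min_le_left _ _) fun t _ h1 h2 => by
        obtain ⟨⟨a, h3, h4⟩, -⟩ := mem_Hr_iff.1 h2
        exact hl ⟨a, h3.trans h1, h4⟩
    exact hray.symm.trans ((hcol _ _ (by omega)).trans (htop _))

theorem AdjIndex.pathConn_compl {j : ℕ} {e : ℤ} (hj : AdjIndex j e) {X : Set Pt} (hX : X.Finite)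
    (h : NoHole j X) : PathConn e Xᶜ := by
  have key : ∀ w ∈ Xᶜ, ∃ w' ∈ (Hr X)ᶜ, PathJoined e Xᶜ w w' := fun w hw => by
    obtain ⟨w', h1, h2⟩ := (h w hw).exists_notMem_finite (finite_Hr hX)
    exact ⟨w', h2, hj.pathJoined h1⟩
  intro x hx y hy
  obtain ⟨x', hx', hxx'⟩ := key x hx
  obtain ⟨y', hy', hyy'⟩ := key y hy
  exact hxx'.trans (((pathConn_compl_Hr hj.bounds.1 hX x' hx' y' hy').mono
    (Set.compl_subset_compl.2 (subset_Hr X))).trans hyy'.symm)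

/-- A finite connected set with connected complement is contractible. -/
theorem AdjIndex.htpyEquiv_singleton {i : ℕ} {e e' : ℤ} (hi : AdjIndex i e) (he' : 0 ≤ e')
    (hee : e + e' = 1) {X : Set Pt} (hX : X.Finite) (hconn : PathConn e X)
    (hcompl : PathConn e' Xᶜ) {z : Pt} (hz : z ∈ X) :
    HtpyEquiv i (subAdj i X) (subAdj i ({z} : Set Pt)) :=
  (hi.htpyEquiv_core he' hee ⟨z, self_mem_rowComp hz⟩ pathConn_rowComp _ X rfl
    (hX.subset Set.sdiff_subset) (rowComp_subset X z) (fun _ hc _ hw => mem_rowComp_trans hw hc)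
    hconn hcompl fun w _ => hX.rowBounded w).trans (hi.htpyEquiv_point hX hz)

theorem AdjIndex.htpyEquiv_compl_Hr {j : ℕ} {e e' : ℤ} (hj : AdjIndex j e') (he : 0 ≤ e)
    (hee : e' + e = 1) {X : Set Pt} (hX : X.Finite) (hconn : PathConn e X)
    (hcompl : PathConn e' Xᶜ) : HtpyEquiv j (subAdj j Xᶜ) (subAdj j (Hr X)ᶜ) := by
  have hdiff : Xᶜ \ (Hr X)ᶜ ⊆ Hr X := fun w hw => not_not.1 hw.2
  have hbd : ∀ w ∈ Hr X, w ∉ X → (∃ a < w.1, (a, w.2) ∈ X) ∧ ∃ c > w.1, (c, w.2) ∈ X := by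
    intro w hw hwX
    obtain ⟨⟨a, h1, h2⟩, c, h3, h4⟩ := mem_Hr_iff.1 hw
    refine ⟨⟨a, h1.lt_of_ne ?_, h2⟩, c, h3.lt_of_ne ?_, h4⟩
    · rintro rfl
      exact hwX h2
    · rintro rfl
      exact hwX h4
  refine hj.htpyEquiv_core he hee (finite_Hr hX).infinite_compl.nonempty
    (pathConn_compl_Hr hj.bounds.1 hX) _ Xᶜ rfl ((finite_Hr hX).subset hdiff)
    (Set.compl_subset_compl.2 (subset_Hr X)) (fun c hc w hw hwH => hc ?_) hcompl
    (by rwa [compl_compl]) fun w hw => ?_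
  · obtain ⟨⟨a, h1, h2⟩, b, h3, h4⟩ := hbd w hwH (rowComp_subset _ _ hw)
    rw [hw.1] at h2 h4
    refine mem_Hr_iff.2 ⟨⟨a, ?_, h2⟩, b, ?_, h4⟩
    · by_contra hlt
      exact hw.2 a (by omega) (by omega) h2
    · by_contra hlt
      exact hw.2 b (by omega) (by omega) h4
  · obtain ⟨⟨a, h1, h2⟩, b, h3, h4⟩ := hbd w (hdiff hw) hw.1
    exact ⟨⟨a, h1, not_not.2 h2⟩, b, h3, not_not.2 h4⟩

/-- a nonempty `c_i`-connected digital picture with no hole is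
homotopy equivalent to its row-convex hull. -/
theorem stmt12 (i j : ℕ) (hij : (i = 1 ∧ j = 2) ∨ (i = 2 ∧ j = 1))
    (X : Set Pt) (hX : X.Finite) (hne : X.Nonempty)
    (hconn : Conn i X) (hnohole : NoHole j X) :
    PicHtpyEquiv i j X (Hr X) := by
  obtain ⟨e, e', hi, hj, hee⟩ : ∃ e e' : ℤ, AdjIndex i e ∧ AdjIndex j e' ∧ e + e' = 1 := by
    rcases hij with ⟨rfl, rfl⟩ | ⟨rfl, rfl⟩
    · exact ⟨0, 1, Or.inl ⟨rfl, rfl⟩, Or.inr ⟨rfl, rfl⟩, by norm_num⟩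
    · exact ⟨1, 0, Or.inr ⟨rfl, rfl⟩, Or.inl ⟨rfl, rfl⟩, by norm_num⟩
  have hXconn : PathConn e X := fun x hx y hy => hi.pathJoined (hconn x hx y hy)
  have hXcompl : PathConn e' Xᶜ := hj.pathConn_compl hX hnohole
  obtain ⟨z, hz⟩ := hne
  refine ⟨?_, hj.htpyEquiv_compl_Hr hi.bounds.1 (by omega) hX hXconn hXcompl⟩
  exact (hi.htpyEquiv_singleton hj.bounds.1 hee hX hXconn hXcompl hz).trans
    (hi.htpyEquiv_singleton hj.bounds.1 hee (finite_Hr hX) (pathConn_Hr hXconn ⟨z, hz⟩)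
      (pathConn_compl_Hr hj.bounds.1 hX) (subset_Hr X hz)).symm
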